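/- If a positive definite d×d matrix B tightly circumscribes V(𝒜), then there exists ω₁ ∈ [0,1] such that B = B_F(ω₁). -/

import Mathlib

open Matrix Set

noncomputable section

/-- `H = [I_d; I_d]`, the two vertically stacked `d×d` identity blocks. -/
def Hmat (d : ℕ) : Matrix (Fin d ⊕ Fin d) (Fin d) ℝ :=
  Matrix.fromRows 1 1

/-- The admissible set `𝒜`: all matrices `P⁽¹⁾ + S` with `P⁽¹⁾` positive
semidefinite with diagonal blocks `P₁` and `P₂`. -/
def Adm (d : ℕ) (P₁ P₂ : Matrix (Fin d) (Fin d) ℝ)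
    (S : Matrix (Fin d ⊕ Fin d) (Fin d ⊕ Fin d) ℝ) :
    Set (Matrix (Fin d ⊕ Fin d) (Fin d ⊕ Fin d) ℝ) :=
  {P | ∃ Q : Matrix (Fin d ⊕ Fin d) (Fin d ⊕ Fin d) ℝ,
      Q.PosSemidef ∧ Q.toBlocks₁₁ = P₁ ∧ Q.toBlocks₂₂ = P₂ ∧ P = Q + S}

/-- The ESCI centralized bound `Bc(ω) = blockdiag(ω⁻¹ P₁, (1-ω)⁻¹ P₂) + S`. -/
def Bc (d : ℕ) (P₁ P₂ : Matrix (Fin d) (Fin d) ℝ)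
    (S : Matrix (Fin d ⊕ Fin d) (Fin d ⊕ Fin d) ℝ) (ω : ℝ) :
    Matrix (Fin d ⊕ Fin d) (Fin d ⊕ Fin d) ℝ :=
  Matrix.fromBlocks (ω⁻¹ • P₁) 0 0 ((1 - ω)⁻¹ • P₂) + S

/-- The fused ESCI precision matrix `A_F(ω) = Hᵀ Bc(ω)⁻¹ H`, continuously
extended at the endpoints. -/
def AF (d : ℕ) (P₁ P₂ : Matrix (Fin d) (Fin d) ℝ)
    (S : Matrix (Fin d ⊕ Fin d) (Fin d ⊕ Fin d) ℝ) (ω : ℝ) :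
    Matrix (Fin d) (Fin d) ℝ :=
  if ω = 0 then (P₂ + S.toBlocks₂₂)⁻¹
  else if ω = 1 then (P₁ + S.toBlocks₁₁)⁻¹
  else (Hmat d)ᵀ * (Bc d P₁ P₂ S ω)⁻¹ * Hmat d

/-- The fused ESCI bound `B_F(ω) = A_F(ω)⁻¹`. -/
def BF (d : ℕ) (P₁ P₂ : Matrix (Fin d) (Fin d) ℝ)
    (S : Matrix (Fin d ⊕ Fin d) (Fin d ⊕ Fin d) ℝ) (ω : ℝ) :
    Matrix (Fin d) (Fin d) ℝ :=
  (AF d P₁ P₂ S ω)⁻¹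

/-- `g(x) = inf_{P ∈ 𝒜} xᵀ Hᵀ P⁻¹ H x`. -/
def gfun (d : ℕ) (P₁ P₂ : Matrix (Fin d) (Fin d) ℝ)
    (S : Matrix (Fin d ⊕ Fin d) (Fin d ⊕ Fin d) ℝ) (x : Fin d → ℝ) : ℝ :=
  ⨅ P : (Adm d P₁ P₂ S),
    x ⬝ᵥ ((Hmat d)ᵀ * ((P : Matrix (Fin d ⊕ Fin d) (Fin d ⊕ Fin d) ℝ))⁻¹ * Hmat d) *ᵥ x

/-- `h_x(ω) = xᵀ A_F(ω) x`. -/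
def hfun (d : ℕ) (P₁ P₂ : Matrix (Fin d) (Fin d) ℝ)
    (S : Matrix (Fin d ⊕ Fin d) (Fin d ⊕ Fin d) ℝ) (x : Fin d → ℝ) (ω : ℝ) : ℝ :=
  x ⬝ᵥ (AF d P₁ P₂ S ω) *ᵥ x

/-- `B` tightly circumscribes `V(𝒜)`: `B` is positive definite, the ellipsoid of
`B` contains `V(𝒜)` (i.e. `xᵀ B⁻¹ x ≤ g(x)` for all `x`), and no smaller
ellipsoid does. -/
def TightlyCircumscribes (d : ℕ) (P₁ P₂ : Matrix (Fin d) (Fin d) ℝ)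
    (S : Matrix (Fin d ⊕ Fin d) (Fin d ⊕ Fin d) ℝ)
    (B : Matrix (Fin d) (Fin d) ℝ) : Prop :=
  B.PosDef ∧ (∀ x : Fin d → ℝ, x ⬝ᵥ B⁻¹ *ᵥ x ≤ gfun d P₁ P₂ S x) ∧
    ∀ Q : Matrix (Fin d) (Fin d) ℝ, Q.PosDef →
      (∀ x : Fin d → ℝ, x ⬝ᵥ Q⁻¹ *ᵥ x ≤ gfun d P₁ P₂ S x) →
      (B - Q).PosSemidef → Q = B

lemma Matrix.IsHermitian.dotProduct_mulVec_comm {n : Type*} [Fintype n] {M : Matrix n n ℝ}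
    (hM : M.IsHermitian) (z w : n → ℝ) : z ⬝ᵥ M *ᵥ w = w ⬝ᵥ M *ᵥ z := by
  have hT : Mᵀ = M := by simpa [IsHermitian] using hM
  rw [dotProduct_mulVec, dotProduct_comm, ← mulVec_transpose, hT]

/-- Cauchy–Schwarz for the bilinear form of a positive semidefinite real matrix. -/
lemma Matrix.PosSemidef.sq_dotProduct_mulVec_le {n : Type*} [Fintype n] {M : Matrix n n ℝ}
    (hM : M.PosSemidef) (z w : n → ℝ) :
    (z ⬝ᵥ M *ᵥ w) ^ 2 ≤ (z ⬝ᵥ M *ᵥ z) * (w ⬝ᵥ M *ᵥ w) := by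
  have hsymm : w ⬝ᵥ M *ᵥ z = z ⬝ᵥ M *ᵥ w := hM.isHermitian.dotProduct_mulVec_comm w z
  have h : ∀ t : ℝ,
      0 ≤ (w ⬝ᵥ M *ᵥ w) * (t * t) + (2 * (z ⬝ᵥ M *ᵥ w)) * t + z ⬝ᵥ M *ᵥ z := by
    intro t
    have := hM.dotProduct_mulVec_nonneg (z + t • w)
    simp only [star_trivial, mulVec_add, mulVec_smul, dotProduct_add, add_dotProduct,
      dotProduct_smul, smul_dotProduct, smul_eq_mul, hsymm] at this
    linarith
  have := discrim_le_zero h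
  simp only [discrim] at this
  linarith

lemma Matrix.PosDef.mulVec_inv_mulVec {n : Type*} [Fintype n] [DecidableEq n]
    {M : Matrix n n ℝ} (hM : M.PosDef) (y : n → ℝ) : M *ᵥ M⁻¹ *ᵥ y = y := by
  rw [mulVec_mulVec, mul_nonsing_inv _ ((isUnit_iff_isUnit_det _).1 hM.isUnit), one_mulVec]

/-- The Legendre transform bound for the quadratic form of a positive definite matrix. -/
lemma Matrix.PosDef.two_mul_dotProduct_sub_le {n : Type*} [Fintype n] [DecidableEq n]
    {M : Matrix n n ℝ} (hM : M.PosDef) (z y : n → ℝ) :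
    2 * (z ⬝ᵥ y) - z ⬝ᵥ M *ᵥ z ≤ y ⬝ᵥ M⁻¹ *ᵥ y := by
  have h := hM.posSemidef.dotProduct_mulVec_nonneg (z - M⁻¹ *ᵥ y)
  have hy := hM.mulVec_inv_mulVec y
  have hs : (M⁻¹ *ᵥ y) ⬝ᵥ M *ᵥ z = z ⬝ᵥ y := by
    rw [hM.isHermitian.dotProduct_mulVec_comm, hy]
  simp only [star_trivial, mulVec_sub, dotProduct_sub, sub_dotProduct, hy, hs] at h
  rw [dotProduct_comm (M⁻¹ *ᵥ y) y] at h
  linarith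

/-- Additivity of the rotated quadratic cone `zᵀ M z ≤ ω s`. -/
lemma cone_add_mem {n : Type*} [Fintype n] {M : Matrix n n ℝ} (hM : M.PosSemidef)
    {z w : n → ℝ} {ω ω' s s' : ℝ} (hω : 0 ≤ ω) (hω' : 0 ≤ ω') (hs : 0 ≤ s) (hs' : 0 ≤ s')
    (hz : z ⬝ᵥ M *ᵥ z ≤ ω * s) (hw : w ⬝ᵥ M *ᵥ w ≤ ω' * s') :
    (z + w) ⬝ᵥ M *ᵥ (z + w) ≤ (ω + ω') * (s + s') := by
  have hsymm : w ⬝ᵥ M *ᵥ z = z ⬝ᵥ M *ᵥ w := hM.isHermitian.dotProduct_mulVec_comm w z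
  have h1 := hM.sq_dotProduct_mulVec_le z w
  have h2 : (z ⬝ᵥ M *ᵥ z) * (w ⬝ᵥ M *ᵥ w) ≤ (ω * s) * (ω' * s') :=
    mul_le_mul hz hw (hM.dotProduct_mulVec_nonneg w) (by positivity)
  have h3 : 2 * (z ⬝ᵥ M *ᵥ w) ≤ ω * s' + ω' * s := by
    refine abs_le_of_sq_le_sq' ?_ (by positivity) |>.2
    nlinarith [sq_nonneg (ω * s' - ω' * s)]
  simp only [mulVec_add, dotProduct_add, add_dotProduct, hsymm]
  nlinarith

lemma dotProduct_Hmat_conj {d : ℕ} (M : Matrix (Fin d ⊕ Fin d) (Fin d ⊕ Fin d) ℝ)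
    (x : Fin d → ℝ) :
    x ⬝ᵥ ((Hmat d)ᵀ * M * Hmat d) *ᵥ x = Sum.elim x x ⬝ᵥ M *ᵥ Sum.elim x x := by
  have h : Hmat d *ᵥ x = Sum.elim x x := by simp [Hmat, fromRows_mulVec]
  rw [← mulVec_mulVec, ← mulVec_mulVec, h, dotProduct_mulVec, vecMul_transpose, h]

/-- `Feasible P₁ P₂ S c x ω` certifies `c ≤ xᵀ A_F(ω) x` by a dual vector `z`, in a form that is
jointly convex in `(z, s₁, s₂, ω)` and closed up to the endpoints `ω = 0, 1`. -/
def Feasible {d : ℕ} (P₁ P₂ : Matrix (Fin d) (Fin d) ℝ)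
    (S : Matrix (Fin d ⊕ Fin d) (Fin d ⊕ Fin d) ℝ) (c : ℝ) (x : Fin d → ℝ) (ω : ℝ) : Prop :=
  ∃ (z : Fin d ⊕ Fin d → ℝ) (s₁ s₂ : ℝ), 0 ≤ s₁ ∧ 0 ≤ s₂ ∧
    (z ∘ Sum.inl) ⬝ᵥ P₁ *ᵥ (z ∘ Sum.inl) ≤ ω * s₁ ∧
    (z ∘ Sum.inr) ⬝ᵥ P₂ *ᵥ (z ∘ Sum.inr) ≤ (1 - ω) * s₂ ∧
    c + s₁ + s₂ + z ⬝ᵥ S *ᵥ z ≤ 2 * (z ⬝ᵥ Sum.elim x x)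

lemma dotProduct_fromBlocks_diagonal {d : ℕ} (P₁ P₂ : Matrix (Fin d) (Fin d) ℝ)
    (z : Fin d ⊕ Fin d → ℝ) :
    z ⬝ᵥ fromBlocks P₁ 0 0 P₂ *ᵥ z =
      (z ∘ Sum.inl) ⬝ᵥ P₁ *ᵥ (z ∘ Sum.inl) + (z ∘ Sum.inr) ⬝ᵥ P₂ *ᵥ (z ∘ Sum.inr) := by
  obtain ⟨z₁, z₂, rfl⟩ : ∃ z₁ z₂, z = Sum.elim z₁ z₂ := ⟨_, _, (Sum.elim_comp_inl_inr z).symm⟩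
  rw [fromBlocks_mulVec]
  simp [sumElim_dotProduct_sumElim]

lemma posSemidef_fromBlocks_diagonal {d : ℕ} {P₁ P₂ : Matrix (Fin d) (Fin d) ℝ}
    (hP₁ : P₁.PosSemidef) (hP₂ : P₂.PosSemidef) : (fromBlocks P₁ 0 0 P₂).PosSemidef := by
  refine .of_dotProduct_mulVec_nonneg ?_ fun z => ?_
  · exact IsHermitian.fromBlocks hP₁.isHermitian (by simp) hP₂.isHermitian
  · rw [star_trivial, dotProduct_fromBlocks_diagonal]
    exact add_nonneg (hP₁.dotProduct_mulVec_nonneg _) (hP₂.dotProduct_mulVec_nonneg _)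

lemma Bc_posDef {d : ℕ} {P₁ P₂ : Matrix (Fin d) (Fin d) ℝ} (hP₁ : P₁.PosDef) (hP₂ : P₂.PosDef)
    {S : Matrix (Fin d ⊕ Fin d) (Fin d ⊕ Fin d) ℝ} (hS : S.PosDef) {ω : ℝ}
    (hω : ω ∈ Icc (0 : ℝ) 1) : (Bc d P₁ P₂ S ω).PosDef :=
  PosDef.posSemidef_add (posSemidef_fromBlocks_diagonal
    (hP₁.posSemidef.smul (inv_nonneg.2 hω.1))
    (hP₂.posSemidef.smul (inv_nonneg.2 (sub_nonneg.2 hω.2)))) hS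

lemma toBlocks₁₁_posDef {d : ℕ} {S : Matrix (Fin d ⊕ Fin d) (Fin d ⊕ Fin d) ℝ}
    (hS : S.PosDef) : S.toBlocks₁₁.PosDef :=
  hS.submatrix Sum.inl_injective

lemma toBlocks₂₂_posDef {d : ℕ} {S : Matrix (Fin d ⊕ Fin d) (Fin d ⊕ Fin d) ℝ}
    (hS : S.PosDef) : S.toBlocks₂₂.PosDef :=
  hS.submatrix Sum.inr_injective

lemma dotProduct_mulVec_elim_zero_left {d : ℕ} (S : Matrix (Fin d ⊕ Fin d) (Fin d ⊕ Fin d) ℝ)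
    (z : Fin d → ℝ) :
    Sum.elim 0 z ⬝ᵥ S *ᵥ Sum.elim 0 z = z ⬝ᵥ S.toBlocks₂₂ *ᵥ z := by
  conv_lhs => rw [← fromBlocks_toBlocks S, fromBlocks_mulVec]
  simp [sumElim_dotProduct_sumElim]

lemma dotProduct_mulVec_elim_zero_right {d : ℕ} (S : Matrix (Fin d ⊕ Fin d) (Fin d ⊕ Fin d) ℝ)
    (z : Fin d → ℝ) :
    Sum.elim z 0 ⬝ᵥ S *ᵥ Sum.elim z 0 = z ⬝ᵥ S.toBlocks₁₁ *ᵥ z := by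
  conv_lhs => rw [← fromBlocks_toBlocks S, fromBlocks_mulVec]
  simp [sumElim_dotProduct_sumElim]

lemma Matrix.PosDef.eq_zero_of_dotProduct_mulVec_nonpos {n : Type*} [Fintype n]
    {M : Matrix n n ℝ} (hM : M.PosDef) {z : n → ℝ} (h : z ⬝ᵥ M *ᵥ z ≤ 0) : z = 0 := by
  by_contra hz
  exact absurd (hM.dotProduct_mulVec_pos hz) (by simpa using h)

lemma feasible_iff {d : ℕ} {P₁ P₂ : Matrix (Fin d) (Fin d) ℝ} (hP₁ : P₁.PosDef)
    (hP₂ : P₂.PosDef) {S : Matrix (Fin d ⊕ Fin d) (Fin d ⊕ Fin d) ℝ} (hS : S.PosDef) {ω : ℝ}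
    (hω : ω ∈ Icc (0 : ℝ) 1) (c : ℝ) (x : Fin d → ℝ) :
    Feasible P₁ P₂ S c x ω ↔ c ≤ x ⬝ᵥ AF d P₁ P₂ S ω *ᵥ x := by
  unfold AF
  split_ifs with h0 h1
  · subst h0
    have hM : (P₂ + S.toBlocks₂₂).PosDef := hP₂.add (toBlocks₂₂_posDef hS)
    constructor
    · rintro ⟨z, s₁, s₂, hs₁, hs₂, hz₁, hz₂, h⟩
      obtain ⟨z₁, z₂, rfl⟩ : ∃ z₁ z₂, z = Sum.elim z₁ z₂ :=
        ⟨_, _, (Sum.elim_comp_inl_inr z).symm⟩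
      simp only [Sum.elim_comp_inl, Sum.elim_comp_inr] at hz₁ hz₂
      obtain rfl : z₁ = 0 := hP₁.eq_zero_of_dotProduct_mulVec_nonpos (by simpa using hz₁)
      have := hM.two_mul_dotProduct_sub_le z₂ x
      rw [dotProduct_mulVec_elim_zero_left] at h
      simp only [sumElim_dotProduct_sumElim, zero_dotProduct, add_mulVec, dotProduct_add] at h this
      linarith
    · intro h
      set z₂ := (P₂ + S.toBlocks₂₂)⁻¹ *ᵥ x with hz
      refine ⟨Sum.elim 0 z₂, 0, z₂ ⬝ᵥ P₂ *ᵥ z₂, le_rfl,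
        hP₂.posSemidef.dotProduct_mulVec_nonneg z₂, by simp, by simp, ?_⟩
      have := congrArg (z₂ ⬝ᵥ ·) (hM.mulVec_inv_mulVec x)
      simp only [← hz, add_mulVec, dotProduct_add] at this
      rw [dotProduct_mulVec_elim_zero_left]
      simp only [sumElim_dotProduct_sumElim, zero_dotProduct]
      rw [dotProduct_comm] at h
      linarith
  · subst h1
    have hM : (P₁ + S.toBlocks₁₁).PosDef := hP₁.add (toBlocks₁₁_posDef hS)
    constructor
    · rintro ⟨z, s₁, s₂, hs₁, hs₂, hz₁, hz₂, h⟩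
      obtain ⟨z₁, z₂, rfl⟩ : ∃ z₁ z₂, z = Sum.elim z₁ z₂ :=
        ⟨_, _, (Sum.elim_comp_inl_inr z).symm⟩
      simp only [Sum.elim_comp_inl, Sum.elim_comp_inr] at hz₁ hz₂
      obtain rfl : z₂ = 0 := hP₂.eq_zero_of_dotProduct_mulVec_nonpos (by simpa using hz₂)
      have := hM.two_mul_dotProduct_sub_le z₁ x
      rw [dotProduct_mulVec_elim_zero_right] at h
      simp only [sumElim_dotProduct_sumElim, zero_dotProduct, add_mulVec, dotProduct_add] at h this
      linarith
    · intro h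
      set z₁ := (P₁ + S.toBlocks₁₁)⁻¹ *ᵥ x with hz
      refine ⟨Sum.elim z₁ 0, z₁ ⬝ᵥ P₁ *ᵥ z₁, 0,
        hP₁.posSemidef.dotProduct_mulVec_nonneg z₁, le_rfl, by simp, by simp, ?_⟩
      have := congrArg (z₁ ⬝ᵥ ·) (hM.mulVec_inv_mulVec x)
      simp only [← hz, add_mulVec, dotProduct_add] at this
      rw [dotProduct_mulVec_elim_zero_right]
      simp only [sumElim_dotProduct_sumElim, zero_dotProduct]
      rw [dotProduct_comm] at h
      linarith
  · have h0' : 0 < ω := lt_of_le_of_ne hω.1 (Ne.symm h0)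
    have h1' : 0 < 1 - ω := sub_pos.2 (lt_of_le_of_ne hω.2 h1)
    have hM := Bc_posDef hP₁ hP₂ hS hω
    have hq : ∀ z : Fin d ⊕ Fin d → ℝ, z ⬝ᵥ Bc d P₁ P₂ S ω *ᵥ z =
        ω⁻¹ * ((z ∘ Sum.inl) ⬝ᵥ P₁ *ᵥ (z ∘ Sum.inl)) +
          (1 - ω)⁻¹ * ((z ∘ Sum.inr) ⬝ᵥ P₂ *ᵥ (z ∘ Sum.inr)) + z ⬝ᵥ S *ᵥ z := by
      intro z
      rw [Bc, add_mulVec, dotProduct_add, dotProduct_fromBlocks_diagonal]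
      simp [smul_mulVec]
    rw [dotProduct_Hmat_conj]
    constructor
    · rintro ⟨z, s₁, s₂, hs₁, hs₂, hz₁, hz₂, h⟩
      have := hM.two_mul_dotProduct_sub_le z (Sum.elim x x)
      rw [hq] at this
      rw [← inv_mul_le_iff₀ h0'] at hz₁
      rw [← inv_mul_le_iff₀ h1'] at hz₂
      linarith
    · intro h
      set z := (Bc d P₁ P₂ S ω)⁻¹ *ᵥ Sum.elim x x with hz
      refine ⟨z, ω⁻¹ * ((z ∘ Sum.inl) ⬝ᵥ P₁ *ᵥ (z ∘ Sum.inl)),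
        (1 - ω)⁻¹ * ((z ∘ Sum.inr) ⬝ᵥ P₂ *ᵥ (z ∘ Sum.inr)),
        mul_nonneg (by positivity) (hP₁.posSemidef.dotProduct_mulVec_nonneg _),
        mul_nonneg (by positivity) (hP₂.posSemidef.dotProduct_mulVec_nonneg _),
        (mul_inv_cancel_left₀ h0'.ne' _).ge, (mul_inv_cancel_left₀ h1'.ne' _).ge, ?_⟩
      have := congrArg (z ⬝ᵥ ·) (hM.mulVec_inv_mulVec (Sum.elim x x))
      simp only [← hz] at this
      rw [hq] at this
      rw [dotProduct_comm] at h
      linarith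

lemma convex_feasible {d : ℕ} {P₁ P₂ : Matrix (Fin d) (Fin d) ℝ} (hP₁ : P₁.PosDef)
    (hP₂ : P₂.PosDef) {S : Matrix (Fin d ⊕ Fin d) (Fin d ⊕ Fin d) ℝ} (hS : S.PosDef)
    (c : ℝ) (x : Fin d → ℝ) :
    Convex ℝ {ω : ℝ | ω ∈ Icc (0 : ℝ) 1 ∧ Feasible P₁ P₂ S c x ω} := by
  rintro ω ⟨hω, z, s₁, s₂, hs₁, hs₂, hz₁, hz₂, h⟩ ω' ⟨hω', z', s₁', s₂', hs₁', hs₂', hz₁', hz₂', h'⟩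
    a b ha hb hab
  have hscale : ∀ {M : Matrix (Fin d) (Fin d) ℝ} {v : Fin d → ℝ} {a p q : ℝ}, 0 ≤ a →
      v ⬝ᵥ M *ᵥ v ≤ p * q → (a • v) ⬝ᵥ M *ᵥ (a • v) ≤ (a * p) * (a * q) := by
    intro M v a p q ha h
    simp only [mulVec_smul, dotProduct_smul, smul_dotProduct, smul_eq_mul]
    nlinarith [mul_le_mul_of_nonneg_left h (mul_nonneg ha ha)]
  have hcomb := cone_add_mem hP₁.posSemidef (mul_nonneg ha hω.1) (mul_nonneg hb hω'.1)
    (mul_nonneg ha hs₁) (mul_nonneg hb hs₁') (hscale ha hz₁) (hscale hb hz₁')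
  have hcomb' := cone_add_mem hP₂.posSemidef (mul_nonneg ha (sub_nonneg.2 hω.2))
    (mul_nonneg hb (sub_nonneg.2 hω'.2)) (mul_nonneg ha hs₂) (mul_nonneg hb hs₂')
    (hscale ha hz₂) (hscale hb hz₂')
  refine ⟨convex_Icc 0 1 hω hω' ha hb hab, a • z + b • z', a * s₁ + b * s₁', a * s₂ + b * s₂',
    by positivity, by positivity, hcomb, ?_, ?_⟩
  · refine hcomb'.trans_eq ?_
    simp only [smul_eq_mul]
    linear_combination (a * s₂ + b * s₂') * hab
  · have hsymm := hS.isHermitian.dotProduct_mulVec_comm z' z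
    have hnn := hS.posSemidef.dotProduct_mulVec_nonneg (z - z')
    simp only [star_trivial, mulVec_sub, dotProduct_sub, sub_dotProduct, hsymm] at hnn
    simp only [mulVec_add, mulVec_smul, dotProduct_add, add_dotProduct, dotProduct_smul,
      smul_dotProduct, smul_eq_mul, hsymm]
    obtain rfl : b = 1 - a := by linarith
    nlinarith [mul_le_mul_of_nonneg_left h ha, mul_le_mul_of_nonneg_left h' hb,
      mul_nonneg (mul_nonneg ha hb) hnn]

lemma Feasible.le_of_mem_Adm {d : ℕ} {P₁ P₂ : Matrix (Fin d) (Fin d) ℝ}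
    {S : Matrix (Fin d ⊕ Fin d) (Fin d ⊕ Fin d) ℝ} (hS : S.PosDef) {c : ℝ} {x : Fin d → ℝ} {ω : ℝ}
    (hω : ω ∈ Icc (0 : ℝ) 1) (h : Feasible P₁ P₂ S c x ω)
    {P : Matrix (Fin d ⊕ Fin d) (Fin d ⊕ Fin d) ℝ} (hP : P ∈ Adm d P₁ P₂ S) :
    c ≤ x ⬝ᵥ ((Hmat d)ᵀ * P⁻¹ * Hmat d) *ᵥ x := by
  obtain ⟨Q, hQ, rfl, rfl, rfl⟩ := hP
  obtain ⟨z, s₁, s₂, hs₁, hs₂, hz₁, hz₂, h⟩ := h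
  obtain ⟨z₁, z₂, rfl⟩ : ∃ z₁ z₂, z = Sum.elim z₁ z₂ := ⟨_, _, (Sum.elim_comp_inl_inr z).symm⟩
  simp only [Sum.elim_comp_inl, Sum.elim_comp_inr] at hz₁ hz₂
  rw [← dotProduct_mulVec_elim_zero_right] at hz₁
  rw [← dotProduct_mulVec_elim_zero_left] at hz₂
  have hadd := cone_add_mem hQ hω.1 (sub_nonneg.2 hω.2) hs₁ hs₂ hz₁ hz₂
  have hz : Sum.elim z₁ (0 : Fin d → ℝ) + Sum.elim (0 : Fin d → ℝ) z₂ = Sum.elim z₁ z₂ := by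
    ext (i | i) <;> simp
  rw [hz] at hadd
  have := (PosDef.posSemidef_add hQ hS).two_mul_dotProduct_sub_le (Sum.elim z₁ z₂) (Sum.elim x x)
  rw [add_mulVec, dotProduct_add] at this
  rw [dotProduct_Hmat_conj]
  linarith

lemma Adm_nonempty {d : ℕ} {P₁ P₂ : Matrix (Fin d) (Fin d) ℝ} (hP₁ : P₁.PosDef)
    (hP₂ : P₂.PosDef) (S : Matrix (Fin d ⊕ Fin d) (Fin d ⊕ Fin d) ℝ) :
    (Adm d P₁ P₂ S).Nonempty :=
  ⟨_, _, posSemidef_fromBlocks_diagonal hP₁.posSemidef hP₂.posSemidef, by simp, by simp, rfl⟩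

lemma Feasible.le_gfun {d : ℕ} {P₁ P₂ : Matrix (Fin d) (Fin d) ℝ} (hP₁ : P₁.PosDef)
    (hP₂ : P₂.PosDef) {S : Matrix (Fin d ⊕ Fin d) (Fin d ⊕ Fin d) ℝ} (hS : S.PosDef)
    {c : ℝ} {x : Fin d → ℝ} {ω : ℝ}
    (hω : ω ∈ Icc (0 : ℝ) 1) (h : Feasible P₁ P₂ S c x ω) : c ≤ gfun d P₁ P₂ S x := by
  have := (Adm_nonempty hP₁ hP₂ S).to_subtype
  exact le_ciInf fun P => h.le_of_mem_Adm hS hω P.2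

lemma Matrix.PosSemidef.abs_apply_le {n : Type*} [Fintype n] [DecidableEq n] {M : Matrix n n ℝ}
    (hM : M.PosSemidef) (i j : n) : |M i j| ≤ (M i i + M j j) / 2 := by
  have h := hM.sq_dotProduct_mulVec_le (Pi.single i 1) (Pi.single j 1)
  simp only [mulVec_single_one, single_one_dotProduct, col_apply] at h
  have hi := hM.diag_nonneg (i := i)
  have hj := hM.diag_nonneg (i := j)
  refine abs_le_of_sq_le_sq ?_ (by positivity)
  nlinarith [sq_nonneg (M i i - M j j)]

lemma isClosed_posSemidef {n : Type*} [Fintype n] :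
    IsClosed {M : Matrix n n ℝ | M.PosSemidef} := by
  have : {M : Matrix n n ℝ | M.PosSemidef} =
      {M | Mᴴ = M} ∩ ⋂ z : n → ℝ, {M | 0 ≤ z ⬝ᵥ M *ᵥ z} := by
    ext M
    simp [posSemidef_iff_dotProduct_mulVec, IsHermitian]
  rw [this]
  refine (isClosed_eq (by fun_prop) continuous_id).inter (isClosed_iInter fun z => ?_)
  exact isClosed_le continuous_const
    (continuous_const.dotProduct (continuous_id.matrix_mulVec continuous_const))

lemma isCompact_posSemidef_toBlocks {d : ℕ} (P₁ P₂ : Matrix (Fin d) (Fin d) ℝ) :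
    IsCompact {Q : Matrix (Fin d ⊕ Fin d) (Fin d ⊕ Fin d) ℝ |
      Q.PosSemidef ∧ Q.toBlocks₁₁ = P₁ ∧ Q.toBlocks₂₂ = P₂} := by
  set p : Fin d ⊕ Fin d → ℝ := Sum.elim (fun i => P₁ i i) (fun i => P₂ i i) with hp
  have hbox : IsCompact {Q : Matrix (Fin d ⊕ Fin d) (Fin d ⊕ Fin d) ℝ |
      ∀ i, ∀ j, Q i j ∈ Icc (-((p i + p j) / 2)) ((p i + p j) / 2)} := by
    have := isCompact_univ_pi fun i => isCompact_univ_pi fun j =>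
      isCompact_Icc (a := -((p i + p j) / 2)) (b := (p i + p j) / 2)
    simp only [Set.pi, mem_univ, true_implies] at this
    exact this
  refine hbox.of_isClosed_subset ?_ ?_
  · refine isClosed_posSemidef.inter (.inter ?_ ?_)
    · exact isClosed_eq (continuous_id.matrix_submatrix _ _) continuous_const
    · exact isClosed_eq (continuous_id.matrix_submatrix _ _) continuous_const
  · rintro Q ⟨hQ, rfl, rfl⟩ i j
    have hdiag : ∀ k, p k = Q k k := by rintro (k | k) <;> simp [hp, toBlocks₁₁, toBlocks₂₂]
    rw [hdiag, hdiag]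
    exact abs_le.1 (hQ.abs_apply_le i j)

/-- The admissible cross-covariance aligned with `z`. -/
lemma exists_posSemidef_toBlocks_aligned {d : ℕ} {P₁ P₂ : Matrix (Fin d) (Fin d) ℝ}
    (hP₁ : P₁.PosDef) (hP₂ : P₂.PosDef) (z₁ z₂ : Fin d → ℝ) :
    ∃ Q : Matrix (Fin d ⊕ Fin d) (Fin d ⊕ Fin d) ℝ, Q.PosSemidef ∧ Q.toBlocks₁₁ = P₁ ∧
      Q.toBlocks₂₂ = P₂ ∧ Sum.elim z₁ z₂ ⬝ᵥ Q *ᵥ Sum.elim z₁ z₂ =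
        (√(z₁ ⬝ᵥ P₁ *ᵥ z₁) + √(z₂ ⬝ᵥ P₂ *ᵥ z₂)) ^ 2 := by
  set n₁ := √(z₁ ⬝ᵥ P₁ *ᵥ z₁) with hn₁
  set n₂ := √(z₂ ⬝ᵥ P₂ *ᵥ z₂) with hn₂
  have hsq₁ : n₁ ^ 2 = z₁ ⬝ᵥ P₁ *ᵥ z₁ := Real.sq_sqrt (hP₁.posSemidef.dotProduct_mulVec_nonneg z₁)
  have hsq₂ : n₂ ^ 2 = z₂ ⬝ᵥ P₂ *ᵥ z₂ := Real.sq_sqrt (hP₂.posSemidef.dotProduct_mulVec_nonneg z₂)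
  set u₁ := n₁⁻¹ • (P₁ *ᵥ z₁) with hu₁
  set u₂ := n₂⁻¹ • (P₂ *ᵥ z₂) with hu₂
  set Q := fromBlocks P₁ (vecMulVec u₁ u₂) (vecMulVec u₂ u₁) P₂ with hQ
  have hform : ∀ a b : Fin d → ℝ, Sum.elim a b ⬝ᵥ Q *ᵥ Sum.elim a b =
      a ⬝ᵥ P₁ *ᵥ a + 2 * ((a ⬝ᵥ u₁) * (b ⬝ᵥ u₂)) + b ⬝ᵥ P₂ *ᵥ b := by
    intro a b
    rw [hQ, fromBlocks_mulVec]
    simp only [Sum.elim_comp_inl, Sum.elim_comp_inr, sumElim_dotProduct_sumElim,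
      vecMulVec_mulVec, dotProduct_add]
    simp only [op_smul_eq_smul, dotProduct_smul, smul_eq_mul]
    rw [dotProduct_comm u₂ b, dotProduct_comm u₁ a]
    ring
  have hbound : ∀ {M : Matrix (Fin d) (Fin d) ℝ} (_ : M.PosDef) (a z : Fin d → ℝ),
      (a ⬝ᵥ ((√(z ⬝ᵥ M *ᵥ z))⁻¹ • (M *ᵥ z))) ^ 2 ≤ a ⬝ᵥ M *ᵥ a := by
    intro M hM a z
    have ha : 0 ≤ a ⬝ᵥ M *ᵥ a := hM.posSemidef.dotProduct_mulVec_nonneg a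
    have hz : 0 ≤ z ⬝ᵥ M *ᵥ z := hM.posSemidef.dotProduct_mulVec_nonneg z
    rw [dotProduct_smul, smul_eq_mul, mul_pow, inv_pow, Real.sq_sqrt hz]
    exact inv_mul_le_of_le_mul₀ hz ha
      ((hM.posSemidef.sq_dotProduct_mulVec_le a z).trans_eq (mul_comm _ _))
  have hself : ∀ {z u : Fin d → ℝ} {n : ℝ}, n ^ 2 = z ⬝ᵥ u → z ⬝ᵥ (n⁻¹ • u) = n := by
    intro z u n h
    rw [dotProduct_smul, ← h, smul_eq_mul]
    rcases eq_or_ne n 0 with rfl | hn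
    · simp
    · field_simp
  refine ⟨Q, .of_dotProduct_mulVec_nonneg ?_ fun z => ?_, by simp [hQ], by simp [hQ], ?_⟩
  · refine IsHermitian.fromBlocks hP₁.isHermitian ?_ hP₂.isHermitian
    rw [conjTranspose_eq_transpose_of_trivial, transpose_vecMulVec]
  · obtain ⟨a, b, rfl⟩ : ∃ a b, z = Sum.elim a b := ⟨_, _, (Sum.elim_comp_inl_inr z).symm⟩
    rw [star_trivial, hform]
    nlinarith [hbound hP₁ a z₁, hbound hP₂ b z₂, sq_nonneg (a ⬝ᵥ u₁ + b ⬝ᵥ u₂)]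
  · rw [hform, hu₁, hu₂, hself hsq₁, hself hsq₂, ← hsq₁, ← hsq₂]
    ring

lemma Matrix.PosDef.continuousAt_inv {n : Type*} [Fintype n] [DecidableEq n] {M : Matrix n n ℝ}
    (hM : M.PosDef) : ContinuousAt (fun N : Matrix n n ℝ => N⁻¹) M := by
  refine continuousAt_matrix_inv M ?_
  rw [Ring.inverse_eq_inv']
  exact continuousAt_inv₀ hM.det_pos.ne'

lemma convex_posSemidef_toBlocks {d : ℕ} (P₁ P₂ : Matrix (Fin d) (Fin d) ℝ) :
    Convex ℝ {Q : Matrix (Fin d ⊕ Fin d) (Fin d ⊕ Fin d) ℝ |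
      Q.PosSemidef ∧ Q.toBlocks₁₁ = P₁ ∧ Q.toBlocks₂₂ = P₂} := by
  rintro Q ⟨hQ, hQ₁, hQ₂⟩ R ⟨hR, hR₁, hR₂⟩ a b ha hb hab
  refine ⟨(hQ.smul ha).add (hR.smul hb), ?_, ?_⟩
  · change a • Q.toBlocks₁₁ + b • R.toBlocks₁₁ = P₁
    rw [hQ₁, hR₁, ← add_smul, hab, one_smul]
  · change a • Q.toBlocks₂₂ + b • R.toBlocks₂₂ = P₂
    rw [hQ₂, hR₂, ← add_smul, hab, one_smul]

/-- A minimizer of `Q ↦ yᵀ (Q + S)⁻¹ y` over a compact convex set of positive semidefinite matrices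
forms a saddle point with the vector `z = (Q + S)⁻¹ y`. -/
lemma exists_saddle {n : Type*} [Fintype n] [DecidableEq n] {K : Set (Matrix n n ℝ)}
    (hK : IsCompact K) (hKc : Convex ℝ K) (hKn : K.Nonempty) (hKp : ∀ Q ∈ K, Q.PosSemidef)
    {S : Matrix n n ℝ} (hS : S.PosDef) (y : n → ℝ) :
    ∃ Q ∈ K, ∀ R ∈ K, ((Q + S)⁻¹ *ᵥ y) ⬝ᵥ R *ᵥ ((Q + S)⁻¹ *ᵥ y) ≤
      ((Q + S)⁻¹ *ᵥ y) ⬝ᵥ Q *ᵥ ((Q + S)⁻¹ *ᵥ y) := by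
  have hpos : ∀ Q ∈ K, (Q + S).PosDef := fun Q hQ => PosDef.posSemidef_add (hKp Q hQ) hS
  have hcont : ∀ Q ∈ K, ContinuousAt (fun Q : Matrix n n ℝ => (Q + S)⁻¹ *ᵥ y) Q := by
    intro Q hQ
    have h1 : ContinuousAt (fun Q : Matrix n n ℝ => (Q + S)⁻¹) Q :=
      ContinuousAt.comp (g := fun N : Matrix n n ℝ => N⁻¹) (f := fun Q => Q + S)
        (hpos Q hQ).continuousAt_inv (by fun_prop)
    have h2 : Continuous fun N : Matrix n n ℝ => N *ᵥ y :=
      continuous_id.matrix_mulVec continuous_const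
    exact h2.continuousAt.comp h1
  have hdot : Continuous fun v : n → ℝ => y ⬝ᵥ v := continuous_const.dotProduct continuous_id
  obtain ⟨Q, hQ, hmin⟩ := hK.exists_isMinOn hKn (f := fun Q => y ⬝ᵥ (Q + S)⁻¹ *ᵥ y)
    fun Q hQ => (hdot.continuousAt.comp (hcont Q hQ)).continuousWithinAt
  refine ⟨Q, hQ, fun R hR => ?_⟩
  set T : ℝ → Matrix n n ℝ := fun t => Q + t • (R - Q) with hT
  set v : ℝ → n → ℝ := fun t => (T t + S)⁻¹ *ᵥ y with hv
  have hT0 : T 0 = Q := by simp [hT]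
  have hvc : ContinuousAt v 0 :=
    ContinuousAt.comp (g := fun Q : Matrix n n ℝ => (Q + S)⁻¹ *ᵥ y) (f := T)
      (by rw [hT0]; exact hcont Q hQ) (by fun_prop)
  have hq : ∀ M : Matrix n n ℝ, Continuous fun w : n → ℝ => w ⬝ᵥ M *ᵥ w := fun M =>
    continuous_id.dotProduct (continuous_const.matrix_mulVec continuous_id)
  have hlim : ContinuousAt (fun t => v t ⬝ᵥ (R - Q) *ᵥ v t) 0 :=
    (hq (R - Q)).continuousAt.comp hvc
  have hle : ∀ t ∈ Ioo (0 : ℝ) 1, v t ⬝ᵥ (R - Q) *ᵥ v t ≤ 0 := by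
    intro t ht
    have hmem : T t ∈ K := by
      have := hKc hQ hR (sub_nonneg.2 ht.2.le) ht.1.le (by ring)
      convert this using 1
      simp only [hT, smul_sub, sub_smul, one_smul]
      abel
    have h1 : y ⬝ᵥ (Q + S)⁻¹ *ᵥ y ≤ y ⬝ᵥ v t := hmin hmem
    have h2 := (hpos Q hQ).two_mul_dotProduct_sub_le (v t) y
    have h3 : v t ⬝ᵥ (T t + S) *ᵥ v t = v t ⬝ᵥ y := by
      rw [hv]; dsimp only; rw [(hpos _ hmem).mulVec_inv_mulVec]
    have h4 : T t + S = (Q + S) + t • (R - Q) := by simp only [hT]; abel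
    rw [h4, add_mulVec, dotProduct_add, smul_mulVec, dotProduct_smul, smul_eq_mul] at h3
    rw [dotProduct_comm y (v t)] at h1
    nlinarith [ht.1]
  have h0 : v 0 ⬝ᵥ (R - Q) *ᵥ v 0 ≤ 0 := by
    refine le_of_tendsto (hlim.tendsto.mono_left (nhdsWithin_le_nhds (s := Ioi 0))) ?_
    filter_upwards [Ioo_mem_nhdsGT (zero_lt_one (α := ℝ))] with t ht using hle t ht
  have hv0 : v 0 = (Q + S)⁻¹ *ᵥ y := by simp [hv, hT0]
  rw [hv0, sub_mulVec, dotProduct_sub] at h0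
  linarith

lemma exists_feasible_gfun {d : ℕ} {P₁ P₂ : Matrix (Fin d) (Fin d) ℝ} (hP₁ : P₁.PosDef)
    (hP₂ : P₂.PosDef) {S : Matrix (Fin d ⊕ Fin d) (Fin d ⊕ Fin d) ℝ} (hS : S.PosDef)
    (x : Fin d → ℝ) :
    ∃ ω ∈ Icc (0 : ℝ) 1, Feasible P₁ P₂ S (gfun d P₁ P₂ S x) x ω := by
  obtain ⟨Q, hQ, hmax⟩ := exists_saddle (isCompact_posSemidef_toBlocks P₁ P₂)
    (convex_posSemidef_toBlocks P₁ P₂)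
    ⟨_, posSemidef_fromBlocks_diagonal hP₁.posSemidef hP₂.posSemidef, by simp, by simp⟩
    (fun Q hQ => hQ.1) hS (Sum.elim x x)
  have hpos : (Q + S).PosDef := PosDef.posSemidef_add hQ.1 hS
  have hg : gfun d P₁ P₂ S x ≤ Sum.elim x x ⬝ᵥ (Q + S)⁻¹ *ᵥ Sum.elim x x := by
    rw [← dotProduct_Hmat_conj]
    refine ciInf_le (ι := Adm d P₁ P₂ S) ⟨0, ?_⟩ ⟨Q + S, Q, hQ.1, hQ.2.1, hQ.2.2, rfl⟩
    rintro _ ⟨⟨_, R, hR, -, -, rfl⟩, rfl⟩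
    dsimp only
    rw [dotProduct_Hmat_conj]
    exact (PosDef.posSemidef_add hR hS).inv.posSemidef.dotProduct_mulVec_nonneg _
  have hy := hpos.mulVec_inv_mulVec (Sum.elim x x)
  set z := (Q + S)⁻¹ *ᵥ Sum.elim x x with hz
  obtain ⟨z₁, z₂, hz₁₂⟩ : ∃ z₁ z₂, z = Sum.elim z₁ z₂ := ⟨_, _, (Sum.elim_comp_inl_inr z).symm⟩
  obtain ⟨R, hR, hR₁, hR₂, hRz⟩ := exists_posSemidef_toBlocks_aligned hP₁ hP₂ z₁ z₂
  have hRle := hmax R ⟨hR, hR₁, hR₂⟩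
  rw [hz₁₂, hRz] at hRle
  have hyz := congrArg (z ⬝ᵥ ·) hy
  simp only [add_mulVec, dotProduct_add] at hyz
  rw [dotProduct_comm] at hg
  rw [hz₁₂] at hyz hg
  set n₁ := √(z₁ ⬝ᵥ P₁ *ᵥ z₁) with hn₁
  set n₂ := √(z₂ ⬝ᵥ P₂ *ᵥ z₂) with hn₂
  have hsq₁ : n₁ ^ 2 = z₁ ⬝ᵥ P₁ *ᵥ z₁ := Real.sq_sqrt (hP₁.posSemidef.dotProduct_mulVec_nonneg z₁)
  have hsq₂ : n₂ ^ 2 = z₂ ⬝ᵥ P₂ *ᵥ z₂ := Real.sq_sqrt (hP₂.posSemidef.dotProduct_mulVec_nonneg z₂)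
  have h1 : 0 ≤ n₁ := Real.sqrt_nonneg _
  have h2 : 0 ≤ n₂ := Real.sqrt_nonneg _
  have hω : n₁ / (n₁ + n₂) ∈ Icc (0 : ℝ) 1 :=
    ⟨by positivity, div_le_one_of_le₀ (by linarith) (by positivity)⟩
  have hmul : (n₁ / (n₁ + n₂)) * (n₁ + n₂) = n₁ :=
    div_mul_cancel_of_imp fun h => by linarith
  refine ⟨_, hω, Sum.elim z₁ z₂, n₁ * (n₁ + n₂), n₂ * (n₁ + n₂), by positivity, by positivity,
    ?_, ?_, ?_⟩
  · simp only [Sum.elim_comp_inl, ← hsq₁]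
    exact le_of_eq (by linear_combination (-n₁) * hmul)
  · simp only [Sum.elim_comp_inr, ← hsq₂]
    exact le_of_eq (by linear_combination n₂ * hmul)
  · linarith

lemma continuous_dotProduct_mulVec_self {n : Type*} [Fintype n] (M : Matrix n n ℝ) :
    Continuous fun z : n → ℝ => z ⬝ᵥ M *ᵥ z :=
  continuous_id.dotProduct (continuous_const.matrix_mulVec continuous_id)

lemma continuous_sumElim_self {n : Type*} :
    Continuous fun x : n → ℝ => (Sum.elim x x : n ⊕ n → ℝ) :=
  continuous_pi fun i => by rcases i with i | i <;> exact continuous_apply i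

lemma Matrix.PosDef.abs_apply_le_of_le {n : Type*} [Fintype n] [DecidableEq n] {M : Matrix n n ℝ}
    (hM : M.PosDef) {z : n → ℝ} {r : ℝ} (hz : z ⬝ᵥ M *ᵥ z ≤ r) (i : n) :
    |z i| ≤ (r + M⁻¹ i i) / 2 := by
  have h1 := hM.two_mul_dotProduct_sub_le z (Pi.single i 1)
  have h2 := hM.two_mul_dotProduct_sub_le z (-Pi.single i 1)
  simp only [mulVec_neg, dotProduct_neg, neg_dotProduct, neg_neg, mulVec_single_one,
    single_one_dotProduct, dotProduct_single_one, col_apply] at h1 h2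
  exact abs_le.2 ⟨by linarith, by linarith⟩

lemma isCompact_feasible {d : ℕ} (P₁ P₂ : Matrix (Fin d) (Fin d) ℝ)
    {S : Matrix (Fin d ⊕ Fin d) (Fin d ⊕ Fin d) ℝ} (hS : S.PosDef)
    {A : Matrix (Fin d) (Fin d) ℝ} (hA : A.PosSemidef)
    {C : Set (Fin d → ℝ)} (hC : IsCompact C) :
    IsCompact {p : (Fin d → ℝ) × ℝ | p.1 ∈ C ∧ p.2 ∈ Icc (0 : ℝ) 1 ∧
      Feasible P₁ P₂ S (p.1 ⬝ᵥ A *ᵥ p.1) p.1 p.2} := by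
  obtain ⟨r, hr⟩ : ∃ r, ∀ x ∈ C, Sum.elim x x ⬝ᵥ S⁻¹ *ᵥ Sum.elim x x ≤ r := by
    obtain ⟨r, hr⟩ := hC.bddAbove_image
      ((continuous_dotProduct_mulVec_self S⁻¹).comp continuous_sumElim_self).continuousOn
    exact ⟨r, fun x hx => hr (mem_image_of_mem _ hx)⟩
  set K : Set ((Fin d → ℝ) × ℝ × (Fin d ⊕ Fin d → ℝ) × ℝ × ℝ) :=
    {p | 0 ≤ p.2.2.2.1 ∧ 0 ≤ p.2.2.2.2 ∧
      (p.2.2.1 ∘ Sum.inl) ⬝ᵥ P₁ *ᵥ (p.2.2.1 ∘ Sum.inl) ≤ p.2.1 * p.2.2.2.1 ∧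
      (p.2.2.1 ∘ Sum.inr) ⬝ᵥ P₂ *ᵥ (p.2.2.1 ∘ Sum.inr) ≤ (1 - p.2.1) * p.2.2.2.2 ∧
      p.1 ⬝ᵥ A *ᵥ p.1 + p.2.2.2.1 + p.2.2.2.2 + p.2.2.1 ⬝ᵥ S *ᵥ p.2.2.1 ≤
        2 * (p.2.2.1 ⬝ᵥ Sum.elim p.1 p.1)} with hKdef
  have hclosed : IsClosed K := by
    have hcomp : ∀ f : Fin d → Fin d ⊕ Fin d,
        Continuous fun p : (Fin d → ℝ) × ℝ × (Fin d ⊕ Fin d → ℝ) × ℝ × ℝ => p.2.2.1 ∘ f :=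
      fun f => continuous_pi fun i => (continuous_apply (f i)).comp (by fun_prop)
    have hz : Continuous fun p : (Fin d → ℝ) × ℝ × (Fin d ⊕ Fin d → ℝ) × ℝ × ℝ => p.2.2.1 := by
      fun_prop
    have h1 := (continuous_dotProduct_mulVec_self P₁).comp (hcomp Sum.inl)
    have h2 := (continuous_dotProduct_mulVec_self P₂).comp (hcomp Sum.inr)
    have h3 := (continuous_dotProduct_mulVec_self A).comp
      (continuous_fst (Y := ℝ × (Fin d ⊕ Fin d → ℝ) × ℝ × ℝ))
    have h4 := (continuous_dotProduct_mulVec_self S).comp hz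
    have h5 := hz.dotProduct (continuous_sumElim_self.comp continuous_fst)
    have hω : Continuous fun p : (Fin d → ℝ) × ℝ × (Fin d ⊕ Fin d → ℝ) × ℝ × ℝ => p.2.1 := by
      fun_prop
    have hs₁ : Continuous fun p : (Fin d → ℝ) × ℝ × (Fin d ⊕ Fin d → ℝ) × ℝ × ℝ => p.2.2.2.1 := by
      fun_prop
    have hs₂ : Continuous fun p : (Fin d → ℝ) × ℝ × (Fin d ⊕ Fin d → ℝ) × ℝ × ℝ => p.2.2.2.2 := by
      fun_prop
    exact (isClosed_le continuous_const hs₁).inter <|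
      (isClosed_le continuous_const hs₂).inter <|
      (isClosed_le h1 (hω.mul hs₁)).inter <|
      (isClosed_le h2 ((continuous_const.sub hω).mul hs₂)).inter <|
      isClosed_le (((h3.add hs₁).add hs₂).add h4) (continuous_const.mul h5)
  have hbox : IsCompact (C ×ˢ Icc (0 : ℝ) 1 ×ˢ
      (univ.pi fun i => Icc (-((4 * r + S⁻¹ i i) / 2)) ((4 * r + S⁻¹ i i) / 2)) ×ˢ
      Icc 0 r ×ˢ Icc 0 r) :=
    hC.prod <| isCompact_Icc.prod <| (isCompact_univ_pi fun _ => isCompact_Icc).prod <|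
      isCompact_Icc.prod isCompact_Icc
  have himage := (hbox.inter_right hclosed).image
    (f := fun p : (Fin d → ℝ) × ℝ × (Fin d ⊕ Fin d → ℝ) × ℝ × ℝ => (p.1, p.2.1)) (by fun_prop)
  convert himage using 1
  ext ⟨x, ω⟩
  constructor
  · rintro ⟨hx, hω, z, s₁, s₂, hs₁, hs₂, hz₁, hz₂, h⟩
    refine ⟨(x, ω, z, s₁, s₂), ⟨⟨hx, hω, ?_, ?_⟩, hs₁, hs₂, hz₁, hz₂, h⟩, rfl⟩
    all_goals
      dsimp only at hx hω hz₁ hz₂ h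
      have hAx : 0 ≤ x ⬝ᵥ A *ᵥ x := hA.dotProduct_mulVec_nonneg x
      have hrx := hr x hx
      have h1 := hS.two_mul_dotProduct_sub_le z (Sum.elim x x)
    · have h2 := hS.two_mul_dotProduct_sub_le z ((2 : ℝ) • Sum.elim x x)
      simp only [mulVec_smul, dotProduct_smul, smul_dotProduct, smul_eq_mul] at h2
      intro i _
      exact abs_le.1 (hS.abs_apply_le_of_le (by linarith) i)
    · exact ⟨⟨hs₁, by linarith⟩, hs₂, by linarith⟩
  · rintro ⟨⟨x', ω', z, s₁, s₂⟩, ⟨⟨hx, hω, -⟩, hK⟩, heq⟩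
    obtain ⟨rfl, rfl⟩ := Prod.mk.inj heq
    exact ⟨hx, hω, z, s₁, s₂, hK⟩

lemma isCompact_feasible_section {d : ℕ} (P₁ P₂ : Matrix (Fin d) (Fin d) ℝ)
    {S : Matrix (Fin d ⊕ Fin d) (Fin d ⊕ Fin d) ℝ} (hS : S.PosDef)
    {A : Matrix (Fin d) (Fin d) ℝ} (hA : A.PosSemidef) (x : Fin d → ℝ) :
    IsCompact {ω : ℝ | ω ∈ Icc (0 : ℝ) 1 ∧ Feasible P₁ P₂ S (x ⬝ᵥ A *ᵥ x) x ω} := by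
  convert (isCompact_feasible P₁ P₂ hS hA (isCompact_singleton (x := x))).image continuous_snd
    using 1
  ext ω
  constructor
  · rintro h
    exact ⟨(x, ω), ⟨rfl, h⟩, rfl⟩
  · rintro ⟨⟨_, _⟩, ⟨rfl, h⟩, rfl⟩
    exact h

/-- On a segment joining two vectors where a quadratic form is negative, up to the sign of one of
them, the form stays negative. -/
lemma exists_segment_neg {n : Type*} [Fintype n] (D : Matrix n n ℝ) {x y : n → ℝ}
    (hx : x ⬝ᵥ D *ᵥ x < 0) (hy : y ⬝ᵥ D *ᵥ y < 0) :
    ∃ y', (y' = y ∨ y' = -y) ∧ ∀ u ∈ segment ℝ x y', u ⬝ᵥ D *ᵥ u < 0 := by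
  have key : ∀ w : n → ℝ, w ⬝ᵥ D *ᵥ w < 0 → x ⬝ᵥ D *ᵥ w + w ⬝ᵥ D *ᵥ x ≤ 0 →
      ∀ u ∈ segment ℝ x w, u ⬝ᵥ D *ᵥ u < 0 := by
    rintro w hw hxw _ ⟨a, b, ha, hb, hab, rfl⟩
    simp only [mulVec_add, mulVec_smul, dotProduct_add, add_dotProduct, dotProduct_smul,
      smul_dotProduct, smul_eq_mul]
    have h1 := mul_nonpos_of_nonneg_of_nonpos (mul_nonneg ha hb) hxw
    rcases ha.eq_or_lt with rfl | ha
    · obtain rfl : b = 1 := by linarith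
      linarith
    · nlinarith [mul_neg_of_pos_of_neg (mul_pos ha ha) hx,
        mul_nonpos_of_nonneg_of_nonpos (mul_nonneg hb hb) hw.le]
  rcases le_total (x ⬝ᵥ D *ᵥ y + y ⬝ᵥ D *ᵥ x) 0 with h | h
  · exact ⟨y, .inl rfl, key y hy h⟩
  · refine ⟨-y, .inr rfl, key (-y) (by simpa [mulVec_neg] using hy) ?_⟩
    simp only [mulVec_neg, dotProduct_neg, neg_dotProduct]
    linarith

lemma feasible_inter_nonempty_of_le {d : ℕ} {P₁ P₂ : Matrix (Fin d) (Fin d) ℝ} (hP₁ : P₁.PosDef)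
    (hP₂ : P₂.PosDef) {S : Matrix (Fin d ⊕ Fin d) (Fin d ⊕ Fin d) ℝ} (hS : S.PosDef)
    {A : Matrix (Fin d) (Fin d) ℝ} (hA : A.PosSemidef)
    (hfeas : ∀ x, ∃ ω ∈ Icc (0 : ℝ) 1, Feasible P₁ P₂ S (x ⬝ᵥ A *ᵥ x) x ω)
    {x y : Fin d → ℝ} {p q : ℝ} (hpq : p ≤ q)
    (hp : p ∈ Icc (0 : ℝ) 1 ∧ Feasible P₁ P₂ S (x ⬝ᵥ A *ᵥ x) x p)
    (hq : q ∈ Icc (0 : ℝ) 1 ∧ Feasible P₁ P₂ S (y ⬝ᵥ A *ᵥ y) y q) :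
    ∃ ω ∈ Icc (0 : ℝ) 1, Feasible P₁ P₂ S (x ⬝ᵥ A *ᵥ x) x ω ∧
      Feasible P₁ P₂ S (y ⬝ᵥ A *ᵥ y) y ω := by
  by_contra! hne
  obtain ⟨ω, hωpq, hωx, hωy⟩ : ∃ ω ∈ Icc p q, ¬ Feasible P₁ P₂ S (x ⬝ᵥ A *ᵥ x) x ω ∧
      ¬ Feasible P₁ P₂ S (y ⬝ᵥ A *ᵥ y) y ω := by
    by_contra! hcover
    obtain ⟨ω, -, hωx, hωy⟩ := isPreconnected_closed_iff.1 (isPreconnected_Icc (a := p) (b := q))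
      _ _ (isCompact_feasible_section P₁ P₂ hS hA x).isClosed
      (isCompact_feasible_section P₁ P₂ hS hA y).isClosed
      (fun ω hω => by
        have h01 : ω ∈ Icc (0 : ℝ) 1 := ⟨hp.1.1.trans hω.1, hω.2.trans hq.1.2⟩
        by_cases h : Feasible P₁ P₂ S (x ⬝ᵥ A *ᵥ x) x ω
        · exact .inl ⟨h01, h⟩
        · exact .inr ⟨h01, hcover ω hω h⟩)
      ⟨p, left_mem_Icc.2 hpq, hp⟩ ⟨q, right_mem_Icc.2 hpq, hq⟩
    exact hne ω hωx.1 hωx.2 hωy.2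
  have h01 : ω ∈ Icc (0 : ℝ) 1 := ⟨hp.1.1.trans hωpq.1, hωpq.2.trans hq.1.2⟩
  have hneg : ∀ u, ¬ Feasible P₁ P₂ S (u ⬝ᵥ A *ᵥ u) u ω ↔
      u ⬝ᵥ (AF d P₁ P₂ S ω - A) *ᵥ u < 0 := by
    intro u
    rw [feasible_iff hP₁ hP₂ hS h01, sub_mulVec, dotProduct_sub, not_le, sub_neg]
  obtain ⟨y', hy', hseg⟩ := exists_segment_neg _ ((hneg x).1 hωx) ((hneg y).1 hωy)
  have hqy' : Feasible P₁ P₂ S (y' ⬝ᵥ A *ᵥ y') y' q := by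
    rcases hy' with rfl | rfl
    · exact hq.2
    · have := hq.2
      rw [feasible_iff hP₁ hP₂ hS hq.1] at this ⊢
      simpa [mulVec_neg] using this
  have hcompact : IsCompact (segment ℝ x y') := by
    rw [← convexHull_pair]
    exact (Set.toFinite {x, y'}).isCompact_convexHull ℝ
  have hK := isCompact_feasible P₁ P₂ hS hA hcompact
  have hL := (hK.inter_right (isClosed_le continuous_snd (continuous_const (y := ω)))).image
    continuous_fst
  have hR := (hK.inter_right (isClosed_le (continuous_const (y := ω)) continuous_snd)).image
    continuous_fst
  obtain ⟨u, hu, ⟨⟨_, a⟩, ⟨⟨-, ha, hua⟩, haω⟩, rfl⟩, ⟨⟨_, b⟩, ⟨⟨-, hb, hub⟩, hωb⟩, rfl⟩⟩ :=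
    isPreconnected_closed_iff.1 (convex_segment x y').isPreconnected _ _ hL.isClosed hR.isClosed
      (fun u hu => by
        obtain ⟨a, ha, hua⟩ := hfeas u
        rcases le_total a ω with h | h
        · exact .inl ⟨(u, a), ⟨⟨hu, ha, hua⟩, h⟩, rfl⟩
        · exact .inr ⟨(u, a), ⟨⟨hu, ha, hua⟩, h⟩, rfl⟩)
      ⟨x, left_mem_segment ℝ x y', (x, p),
        ⟨⟨left_mem_segment ℝ x y', hp.1, hp.2⟩, hωpq.1⟩, rfl⟩
      ⟨y', right_mem_segment ℝ x y', (y', q),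
        ⟨⟨right_mem_segment ℝ x y', hq.1, hqy'⟩, hωpq.2⟩, rfl⟩
  have hωu := (convex_feasible hP₁ hP₂ hS _ _).ordConnected.out ⟨ha, hua⟩ ⟨hb, hub⟩ ⟨haω, hωb⟩
  exact (hneg _).2 (hseg _ hu) hωu.2

lemma exists_forall_le_AF {d : ℕ} {P₁ P₂ : Matrix (Fin d) (Fin d) ℝ} (hP₁ : P₁.PosDef)
    (hP₂ : P₂.PosDef) {S : Matrix (Fin d ⊕ Fin d) (Fin d ⊕ Fin d) ℝ} (hS : S.PosDef)
    {A : Matrix (Fin d) (Fin d) ℝ} (hA : A.PosSemidef)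
    (hAg : ∀ x : Fin d → ℝ, x ⬝ᵥ A *ᵥ x ≤ gfun d P₁ P₂ S x) :
    ∃ ω ∈ Icc (0 : ℝ) 1, ∀ x : Fin d → ℝ, x ⬝ᵥ A *ᵥ x ≤ x ⬝ᵥ AF d P₁ P₂ S ω *ᵥ x := by
  have hfeas : ∀ x, ∃ ω ∈ Icc (0 : ℝ) 1, Feasible P₁ P₂ S (x ⬝ᵥ A *ᵥ x) x ω := by
    intro x
    obtain ⟨ω, hω, h⟩ := exists_feasible_gfun hP₁ hP₂ hS x
    rw [feasible_iff hP₁ hP₂ hS hω] at h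
    exact ⟨ω, hω, (feasible_iff hP₁ hP₂ hS hω _ _).2 ((hAg x).trans h)⟩
  have hpair : ∀ x y, ∃ ω ∈ Icc (0 : ℝ) 1, Feasible P₁ P₂ S (x ⬝ᵥ A *ᵥ x) x ω ∧
      Feasible P₁ P₂ S (y ⬝ᵥ A *ᵥ y) y ω := by
    intro x y
    obtain ⟨p, hp⟩ := hfeas x
    obtain ⟨q, hq⟩ := hfeas y
    rcases le_total p q with h | h
    · exact feasible_inter_nonempty_of_le hP₁ hP₂ hS hA hfeas h hp hq
    · obtain ⟨ω, hω, hy, hx⟩ := feasible_inter_nonempty_of_le hP₁ hP₂ hS hA hfeas h hq hp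
      exact ⟨ω, hω, hx, hy⟩
  obtain ⟨ω, hω⟩ := Convex.helly_theorem_compact' (𝕜 := ℝ)
    (F := fun x => {ω : ℝ | ω ∈ Icc (0 : ℝ) 1 ∧ Feasible P₁ P₂ S (x ⬝ᵥ A *ᵥ x) x ω})
    (fun x => convex_feasible hP₁ hP₂ hS _ x)
    (fun x => isCompact_feasible_section P₁ P₂ hS hA x) <| by
      intro I hI
      rw [Module.finrank_self] at hI
      obtain ⟨x, y, hxy⟩ : ∃ x y, I ⊆ {x, y} := by
        rcases hI.lt_or_eq with h | h
        · obtain ⟨x, hx⟩ := Finset.card_le_one_iff_subset_singleton.1 (Nat.le_of_lt_succ h)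
          exact ⟨x, x, by simpa using hx⟩
        · obtain ⟨x, y, -, rfl⟩ := Finset.card_eq_two.1 h
          exact ⟨x, y, subset_rfl⟩
      obtain ⟨ω, hω, hx, hy⟩ := hpair x y
      refine ⟨ω, mem_iInter₂.2 fun z hz => ⟨hω, ?_⟩⟩
      have := hxy hz
      simp only [Finset.mem_insert, Finset.mem_singleton] at this
      rcases this with rfl | rfl
      exacts [hx, hy]
  rw [mem_iInter] at hω
  exact ⟨ω, (hω 0).1, fun x => (feasible_iff hP₁ hP₂ hS (hω 0).1 _ x).1 (hω x).2⟩

lemma AF_isHermitian {d : ℕ} {P₁ P₂ : Matrix (Fin d) (Fin d) ℝ} (hP₁ : P₁.PosDef)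
    (hP₂ : P₂.PosDef) {S : Matrix (Fin d ⊕ Fin d) (Fin d ⊕ Fin d) ℝ} (hS : S.PosDef) {ω : ℝ}
    (hω : ω ∈ Icc (0 : ℝ) 1) : (AF d P₁ P₂ S ω).IsHermitian := by
  unfold AF
  split_ifs
  · exact (hP₂.add (toBlocks₂₂_posDef hS)).inv.isHermitian
  · exact (hP₁.add (toBlocks₁₁_posDef hS)).inv.isHermitian
  · rw [← conjTranspose_eq_transpose_of_trivial]
    exact isHermitian_conjTranspose_mul_mul _ (Bc_posDef hP₁ hP₂ hS hω).inv.isHermitian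

/-- every tight circumscribing bound is an ESCI bound. -/
theorem tight_is_esci (d : ℕ) (hd : 1 ≤ d)
    (P₁ P₂ : Matrix (Fin d) (Fin d) ℝ) (hP₁ : P₁.PosDef) (hP₂ : P₂.PosDef)
    (S : Matrix (Fin d ⊕ Fin d) (Fin d ⊕ Fin d) ℝ) (hS : S.PosDef)
    (B : Matrix (Fin d) (Fin d) ℝ)
    (hB : TightlyCircumscribes d P₁ P₂ S B) :
    ∃ ω₁ ∈ Set.Icc (0 : ℝ) 1, B = BF d P₁ P₂ S ω₁ := by
  obtain ⟨hBpos, hBg, hBmin⟩ := hB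
  obtain ⟨ω, hω, hle⟩ := exists_forall_le_AF hP₁ hP₂ hS hBpos.inv.posSemidef hBg
  have hsub : (AF d P₁ P₂ S ω - B⁻¹).PosSemidef := by
    refine .of_dotProduct_mulVec_nonneg
      ((AF_isHermitian hP₁ hP₂ hS hω).sub hBpos.inv.isHermitian) fun x => ?_
    rw [star_trivial, sub_mulVec, dotProduct_sub]
    exact sub_nonneg.2 (hle x)
  have hpos : (AF d P₁ P₂ S ω).PosDef := by
    simpa using hBpos.inv.add_posSemidef hsub
  refine ⟨ω, hω, (hBmin _ hpos.inv (fun x => ?_) ?_).symm⟩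
  · rw [nonsing_inv_nonsing_inv _ ((isUnit_iff_isUnit_det _).1 hpos.isUnit)]
    exact ((feasible_iff hP₁ hP₂ hS hω _ x).2 le_rfl).le_gfun hP₁ hP₂ hS hω
  · refine .of_dotProduct_mulVec_nonneg
      (hBpos.isHermitian.sub hpos.inv.isHermitian) fun x => ?_
    rw [star_trivial, sub_mulVec, dotProduct_sub, sub_nonneg]
    set z := (AF d P₁ P₂ S ω)⁻¹ *ᵥ x with hz
    have h1 := hBpos.inv.two_mul_dotProduct_sub_le z x
    rw [nonsing_inv_nonsing_inv _ ((isUnit_iff_isUnit_det _).1 hBpos.isUnit)] at h1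
    have h2 : z ⬝ᵥ AF d P₁ P₂ S ω *ᵥ z = z ⬝ᵥ x := by rw [hz, hpos.mulVec_inv_mulVec]
    have h3 := hle z
    rw [dotProduct_comm x z]
    linarith
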